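/- For every positive integer n, the number of plane partitions S contained in the 2n×2n×2n box that are totally symmetric (i.e., S is invariant under all six permutations of the three coordinates) and self-complementary (i.e., (i,j,k) ∈ S if and only if (2n-1-i, 2n-1-j, 2n-1-k) ∉ S) equals ∏_{i=0}^{n-1} (3i+1)! / (n+i)!. -/

import Mathlib

section

open Polynomial

/-- The bilinear form on polynomials for which `X ^ a` pairs with `X ^ b` to `2` if `a < b`, to `1` if
`a = b`, and to `0` if `a > b`; the second index is the first argument. -/
noncomputable def orderForm : LinearMap.BilinForm ℚ ℚ[X] :=
  (basisMonomials ℚ).constr ℚ fun b => (basisMonomials ℚ).constr ℚ fun a =>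
    if a < b then 2 else if a = b then 1 else 0

theorem orderForm_X_pow (a b : ℕ) :
    orderForm (X ^ b) (X ^ a) = if a < b then 2 else if a = b then 1 else 0 := by
  have h (c : ℕ) : (X ^ c : ℚ[X]) = basisMonomials ℚ c := by simp [X_pow_eq_monomial]
  simp only [orderForm, h, Module.Basis.constr_basis]

theorem orderForm_add_flip (f g : ℚ[X]) :
    orderForm f g + orderForm g f = 2 * (f.eval 1 * g.eval 1) := by
  induction f using Polynomial.induction_on' with
  | add p q hp hq => simp only [map_add, LinearMap.add_apply, eval_add]; linarith
  | monomial b r =>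
    induction g using Polynomial.induction_on' with
    | add p q hp hq => simp only [map_add, LinearMap.add_apply, eval_add]; linarith
    | monomial a s =>
      simp only [← C_mul_X_pow_eq_monomial, ← smul_eq_C_mul, map_smul, LinearMap.smul_apply,
        orderForm_X_pow, smul_eq_mul, eval_smul, eval_pow, eval_X, one_pow]
      rcases lt_trichotomy a b with h | h | h
      · simp [h, h.not_gt, h.ne']; ring
      · simp [h]; ring
      · simp [h, h.not_gt, h.ne']; ring

theorem orderForm_self (f : ℚ[X]) : orderForm f f = f.eval 1 * f.eval 1 := by
  linarith [orderForm_add_flip f f]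

/-- The linear functional on the exterior algebra of `ℚ[X]` which is `1` on every wedge of monomials
with increasing exponents. -/
noncomputable def wedgeSum : ExteriorAlgebra ℚ ℚ[X] →ₗ[ℚ] ℚ :=
  (CliffordAlgebra.lift orderForm.toQuadraticMap
    ⟨leval 1, fun f => by simp [orderForm_self]⟩).toLinearMap ∘ₗ
  CliffordAlgebra.changeForm (Q := 0) (Q' := orderForm.toQuadraticMap) (B := orderForm) (by simp)

theorem wedgeSum_one : wedgeSum 1 = 1 := by
  simp [wedgeSum]

theorem wedgeSum_ι_mul (w : ℚ[X]) (x : ExteriorAlgebra ℚ ℚ[X]) :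
    wedgeSum (ExteriorAlgebra.ι ℚ w * x) = w.eval 1 * wedgeSum x -
      wedgeSum (CliffordAlgebra.contractLeft (orderForm w) x) := by
  simp only [wedgeSum, ExteriorAlgebra.ι, CliffordAlgebra.changeForm_ι_mul,
    CliffordAlgebra.changeForm_contractLeft, LinearMap.comp_apply, AlgHom.toLinearMap_apply,
    map_sub, map_mul]
  rw [CliffordAlgebra.lift_ι_apply, leval_apply]

theorem contractLeft_ιMulti_mul {d : Module.Dual ℚ ℚ[X]} {m : ℕ} {v : Fin m → ℚ[X]}
    (hv : ∀ i, d (v i) = 0) (x : ExteriorAlgebra ℚ ℚ[X]) :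
    (CliffordAlgebra.contractLeft d (ExteriorAlgebra.ιMulti ℚ m v * x) :
        ExteriorAlgebra ℚ ℚ[X]) =
      (-1 : ℚ) ^ m • (ExteriorAlgebra.ιMulti ℚ m v * CliffordAlgebra.contractLeft d x) := by
  induction m with
  | zero => simp
  | succ m ih =>
    rw [ExteriorAlgebra.ιMulti_succ_apply, mul_assoc, ExteriorAlgebra.ι,
      CliffordAlgebra.contractLeft_ι_mul, hv 0, ih (v := Matrix.vecTail v) fun i => hv i.succ]
    simp [pow_succ, mul_assoc]

theorem contractLeft_ιMulti {d : Module.Dual ℚ ℚ[X]} {m : ℕ} {v : Fin m → ℚ[X]}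
    (hv : ∀ i, d (v i) = 0) :
    CliffordAlgebra.contractLeft d (ExteriorAlgebra.ιMulti ℚ m v) = 0 := by
  simpa using contractLeft_ιMulti_mul hv 1

theorem wedgeSum_ιMulti_X_pow {m : ℕ} {p : Fin m → ℕ} (hp : StrictMono p) :
    wedgeSum (ExteriorAlgebra.ιMulti ℚ m fun i => X ^ p i) = 1 := by
  induction m with
  | zero => simp [wedgeSum_one]
  | succ m ih =>
    rw [ExteriorAlgebra.ιMulti_succ_apply, wedgeSum_ι_mul, contractLeft_ιMulti]
    · simpa [Matrix.vecTail, Function.comp_def] using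
        ih (p := fun i => p i.succ) fun i j h => hp (Fin.succ_lt_succ_iff.2 h)
    · intro i
      have := hp i.succ_pos
      simp [Matrix.vecTail, orderForm_X_pow, this.not_gt, this.ne']

/-- The exterior product of `u, u ^ 2, …, u ^ m` where `u = X (1 + X)`. -/
noncomputable def powWedge (m : ℕ) : ExteriorAlgebra ℚ ℚ[X] :=
  ExteriorAlgebra.ιMulti ℚ m fun i => (X * (1 + X)) ^ (i.val + 1)

theorem powWedge_succ (m : ℕ) :
    powWedge (m + 1) = powWedge m * ExteriorAlgebra.ι ℚ ((X * (1 + X)) ^ (m + 1)) := by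
  simp only [powWedge, ExteriorAlgebra.ιMulti_apply]
  rw [List.ofFn_succ', List.prod_concat]
  simp only [Fin.val_castSucc, Fin.val_last]

theorem ι_pow_mul_powWedge {m j : ℕ} (hj : j < m) :
    ExteriorAlgebra.ι ℚ ((X * (1 + X)) ^ (j + 1) : ℚ[X]) * powWedge m = 0 :=
  ExteriorAlgebra.ι_mul_prod_list (fun i : Fin m => (X * (1 + X) : ℚ[X]) ^ (i.val + 1)) ⟨j, hj⟩

theorem wedgeSum_powWedge_succ {m : ℕ} {w : ℚ[X]}
    (hw : ExteriorAlgebra.ι ℚ w * powWedge (m + 1) = 0)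
    (h : ∀ i < m, orderForm w ((X * (1 + X)) ^ (i + 1)) = 0) :
    w.eval 1 * wedgeSum (powWedge (m + 1)) =
      (-1) ^ m * orderForm w ((X * (1 + X)) ^ (m + 1)) * wedgeSum (powWedge m) := by
  have h1 := wedgeSum_ι_mul w (powWedge (m + 1))
  rw [hw, map_zero, eq_comm, sub_eq_zero] at h1
  rw [h1, powWedge_succ, powWedge, contractLeft_ιMulti_mul fun i => h i i.2, ← powWedge,
    ExteriorAlgebra.ι, CliffordAlgebra.contractLeft_ι, ← Algebra.commutes, ← Algebra.smul_def]
  simp [mul_assoc]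

theorem orderForm_X_sub_one_mul (H : ℚ[X]) (k : ℕ) :
    orderForm ((X - 1) * H) ((X * (1 + X)) ^ k) = ((1 + X) ^ (k + 1) * H).coeff (2 * k) := by
  have key (b : ℕ) (f : ℚ[X]) :
      orderForm (X ^ (b + 1) - X ^ b) f = ((1 + X) * f).coeff (b + 1) := by
    induction f using Polynomial.induction_on' with
    | add p q hp hq => simp only [map_add, mul_add, coeff_add, hp, hq]
    | monomial a s =>
      simp only [← C_mul_X_pow_eq_monomial, ← smul_eq_C_mul, map_smul, map_sub,
        LinearMap.sub_apply, orderForm_X_pow, add_mul, mul_smul_comm, one_mul, ← pow_succ',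
        coeff_smul, coeff_add, coeff_X_pow]
      congr 1
      split_ifs <;> first | omega | norm_num
  induction H using Polynomial.induction_on' with
  | add p q hp hq =>
    rw [mul_add, mul_add ((1 + X) ^ (k + 1)), map_add, LinearMap.add_apply, hp, hq, coeff_add]
  | monomial b s =>
    have : (X - 1) * (monomial b s : ℚ[X]) = s • (X ^ (b + 1) - X ^ b) := by
      rw [← C_mul_X_pow_eq_monomial, smul_eq_C_mul]; ring
    rw [this, map_smul, LinearMap.smul_apply, key, ← C_mul_X_pow_eq_monomial, ← smul_eq_C_mul,
      mul_smul_comm, coeff_smul]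
    congr 1
    rw [show (1 + X : ℚ[X]) * (X * (1 + X)) ^ k = (1 + X) ^ (k + 1) * X ^ k by
      rw [mul_pow]; ring,
      coeff_mul_X_pow', coeff_mul_X_pow']
    simp only [coeff_one_add_X_pow]
    split_ifs with h1 h2 h2
    · rw [Nat.choose_symm_of_eq_add]
      omega
    · rw [Nat.choose_eq_zero_of_lt (by omega), Nat.cast_zero]
    · rw [Nat.choose_eq_zero_of_lt (by omega), Nat.cast_zero]
    · rfl

theorem orderForm_one_pow {k : ℕ} (hk : k ≠ 0) :
    orderForm 1 ((X * (1 + X)) ^ k) = 0 := by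
  have key (f : ℚ[X]) : orderForm 1 f = f.coeff 0 := by
    induction f using Polynomial.induction_on' with
    | add p q hp hq => simp only [map_add, coeff_add, hp, hq]
    | monomial a s =>
      rw [← pow_zero (X : ℚ[X])]
      simp only [← C_mul_X_pow_eq_monomial, ← smul_eq_C_mul, map_smul, orderForm_X_pow,
        coeff_smul, coeff_X_pow]
      congr 1
      split_ifs <;> first | omega | norm_num
  rw [key, coeff_zero_eq_eval_zero]
  simp [hk]

theorem orderForm_pow_sub (j k : ℕ) :
    orderForm ((X * (1 + X)) ^ (j + 1) - 2 * (X * (1 + X)) ^ j) ((X * (1 + X)) ^ k) =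
      if j ≤ 2 * k then ((k + j + 2).choose (2 * k - j) + (k + j + 1).choose (2 * k - j) : ℚ)
      else 0 := by
  rw [show ((X * (1 + X)) ^ (j + 1) : ℚ[X]) - 2 * (X * (1 + X)) ^ j =
    (X - 1) * ((X + 2) * (X * (1 + X)) ^ j) by ring, orderForm_X_sub_one_mul,
    show (1 + X) ^ (k + 1) * ((X + 2) * (X * (1 + X)) ^ j : ℚ[X]) =
      ((1 + X) ^ (k + j + 2) + (1 + X) ^ (k + j + 1)) * X ^ j by
      rw [mul_pow]; ring, coeff_mul_X_pow']
  simp [coeff_one_add_X_pow]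

/-- The reciprocal factorial, extended by zero to the negative integers. -/
def invFactorial (z : ℤ) : ℚ :=
  if 0 ≤ z then (z.toNat.factorial : ℚ)⁻¹ else 0

theorem invFactorial_natCast (n : ℕ) : invFactorial n = (n.factorial : ℚ)⁻¹ := by
  simp [invFactorial]

theorem invFactorial_of_neg {z : ℤ} (hz : z < 0) : invFactorial z = 0 := by
  simp [invFactorial, hz.not_ge]

theorem invFactorial_sub_one (z : ℤ) : invFactorial (z - 1) = z * invFactorial z := by
  rcases lt_trichotomy z 0 with h | rfl | h
  · rw [invFactorial_of_neg h, invFactorial_of_neg (by omega), mul_zero]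
  · rw [invFactorial_of_neg (by omega), Int.cast_zero, zero_mul]
  · obtain ⟨n, rfl⟩ : ∃ n : ℕ, z = n + 1 := ⟨(z - 1).toNat, by omega⟩
    rw [add_sub_cancel_right, invFactorial_natCast, ← Nat.cast_succ, invFactorial_natCast,
      Nat.factorial_succ]
    have := n.factorial_ne_zero
    push_cast
    field_simp

theorem cast_choose_eq_invFactorial (a b : ℕ) :
    (a.choose b : ℚ) = a.factorial * invFactorial b * invFactorial (a - b) := by
  rcases le_or_gt b a with h | h
  · rw [← Nat.cast_sub h, invFactorial_natCast, invFactorial_natCast, Nat.cast_choose ℚ h]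
    field_simp
  · rw [Nat.choose_eq_zero_of_lt h, invFactorial_of_neg (z := a - b) (by omega)]
    simp

theorem choose_add_choose_eq_invFactorial (k j : ℕ) :
    (if j ≤ 2 * k then ((k + j + 2).choose (2 * k - j) + (k + j + 1).choose (2 * k - j) : ℚ)
      else 0) =
    (k + j + 1).factorial * (3 * j + 4) * invFactorial (2 * k - j) *
      invFactorial (2 * j - k + 2) := by
  split_ifs with h
  · have h1 := invFactorial_sub_one (2 * j - k + 2)
    rw [cast_choose_eq_invFactorial, cast_choose_eq_invFactorial, Nat.factorial_succ,
      show ((2 * k - j : ℕ) : ℤ) = 2 * k - j by omega,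
      show (((k + j + 1 + 1 : ℕ) : ℤ) - (2 * k - j)) = 2 * j - k + 2 by push_cast; ring,
      show (((k + j + 1 : ℕ) : ℤ) - (2 * k - j)) = 2 * j - k + 2 - 1 by push_cast; ring, h1]
    push_cast
    ring
  · rw [invFactorial_of_neg (z := 2 * k - j) (by omega)]
    simp

/-- The coefficients of the relation which annihilates the first powers of `X (1 + X)`. -/
def relCoeff (m : ℕ) : ℕ → ℚ
  | 0 => 1
  | j + 1 => relCoeff m j * (-2 * (2 * j + 3) * (m - 1 - j) * (m + 2 + j) /
      ((j + 2) * (2 * m - 1 - j) * (2 * m + 3 + j)))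

theorem relCoeff_self {m : ℕ} (hm : 0 < m) : relCoeff m m = 0 := by
  obtain ⟨q, rfl⟩ := Nat.exists_eq_add_of_le' hm
  simp [relCoeff]

theorem relCoeff_succ_mul {m j : ℕ} (h : j < m) :
    relCoeff m (j + 1) * ((j + 2) * (2 * m - 1 - j) * (2 * m + 3 + j)) =
      relCoeff m j * (-2 * (2 * j + 3) * (m - 1 - j) * (m + 2 + j)) := by
  have h1 : (j : ℚ) + 1 ≤ m := mod_cast h
  have h2 : (2 * m - 1 - j : ℚ) ≠ 0 := by
    have : (0 : ℚ) ≤ j := j.cast_nonneg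
    linarith
  have h3 : (2 * m + 3 + j : ℚ) ≠ 0 := by positivity
  have h4 : (j + 2 : ℚ) ≠ 0 := by positivity
  rw [relCoeff]
  field_simp

theorem relCoeff_mul_factorial (j t : ℕ) :
    relCoeff (j + t + 1) j * (j.factorial * (j + 1).factorial * t.factorial *
      (j + t + 2).factorial * (2 * j + 2 * t + 1).factorial * (3 * j + 2 * t + 4).factorial) =
    (-1) ^ j * (2 * j + 1).factorial * (j + t).factorial * (2 * j + t + 2).factorial *
      (j + 2 * t + 1).factorial * (2 * j + 2 * t + 4).factorial := by
  obtain ⟨m, hm⟩ : ∃ m, m = j + t + 1 := ⟨_, rfl⟩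
  rw [← hm]
  induction j generalizing t with
  | zero =>
    simp only [relCoeff, mul_zero, zero_add]
    ring
  | succ j ih =>
    have ih := ih (t + 1) (by omega)
    have hs := relCoeff_succ_mul (m := m) (j := j) (by omega)
    have hm' : (m : ℚ) = j + t + 2 := by rw [hm]; push_cast; ring
    rw [show j + 1 + t = j + (t + 1) by ring,
      show 2 * (j + 1) + 2 * t + 1 = 2 * j + 2 * (t + 1) + 1 by ring,
      show 3 * (j + 1) + 2 * t + 4 = 3 * j + 2 * (t + 1) + 4 + 1 by ring,
      show 2 * (j + 1) + 1 = 2 * j + 1 + 1 + 1 by ring,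
      show 2 * (j + 1) + t + 2 = 2 * j + (t + 1) + 2 + 1 by ring,
      show 2 * (j + 1) + 2 * t + 4 = 2 * j + 2 * (t + 1) + 4 by ring,
      Nat.factorial_succ (j + 1), Nat.factorial_succ (3 * j + 2 * (t + 1) + 4),
      Nat.factorial_succ (2 * j + 1 + 1), Nat.factorial_succ (2 * j + 1),
      Nat.factorial_succ (2 * j + (t + 1) + 2)]
    rw [show j + 2 * (t + 1) + 1 = j + 1 + 2 * t + 1 + 1 by ring,
      Nat.factorial_succ (j + 1 + 2 * t + 1), Nat.factorial_succ t] at ih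
    rw [Nat.factorial_succ j] at ih ⊢
    rw [hm'] at hs
    push_cast at ih hs ⊢
    have h1 : ((j : ℚ) + 2 * t + 3) * (t + 1) ≠ 0 := by positivity
    apply mul_left_cancel₀ h1
    linear_combination ((t + 1) * (j + 1) ^ 2 * j.factorial ^ 2 * t.factorial *
      (j + (t + 1) + 2).factorial * (2 * j + 2 * (t + 1) + 1).factorial *
      (3 * j + 2 * (t + 1) + 4).factorial : ℚ) * hs +
      (-2 * (2 * j + 3) * (2 * j + t + 4) * (t + 1) * (j + 1) : ℚ) * ih

/-- The summand whose sum over `j` is the value of the relation at the `k`-th power. -/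
def relTerm (m k j : ℕ) : ℚ :=
  relCoeff m j * ((k + j + 1).factorial * (3 * j + 4) * invFactorial (2 * k - j) *
    invFactorial (2 * j - k + 2))

/-- The Wilf–Zeilberger mate of `relTerm`. -/
def relMate (m k j : ℕ) : ℚ :=
  relCoeff m j * ((j + 1) * (2 * m - j) * (2 * m + 2 + j)) * ((k + j + 1).factorial *
    invFactorial (2 * k + 2 - j) * invFactorial (2 * j - k))

theorem relTerm_recurrence {m j : ℕ} (k : ℕ) (h : j < m) :
    2 * (2 * k + 3) * (k + 1 - m) * (k + m + 2) * relTerm m (k + 1) j -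
      (k + 1) * (2 * m - k) * (2 * m + 2 + k) * relTerm m k j =
    (3 * k + 4) * (relMate m k (j + 1) - relMate m k j) := by
  have hs := relCoeff_succ_mul h
  have a1 : invFactorial (2 * k + 2 - (j + 1)) =
      (2 * k + 2 - j) * invFactorial (2 * k + 2 - j) := by
    simpa [sub_sub] using invFactorial_sub_one (2 * k + 2 - j)
  have a2 : invFactorial (2 * k - j) = (2 * k + 1 - j) * invFactorial (2 * k + 2 - (j + 1)) := by
    have := invFactorial_sub_one (2 * k + 2 - (j + 1))
    rw [show (2 * k + 2 - (j + 1) - 1 : ℤ) = 2 * k - j by ring] at this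
    rw [this]
    push_cast
    ring
  have b1 : invFactorial (2 * j - (k + 1) + 2) =
      (2 * j - k + 2) * invFactorial (2 * j - k + 2) := by
    have := invFactorial_sub_one (2 * j - k + 2)
    rw [show (2 * j - k + 2 - 1 : ℤ) = 2 * j - (k + 1) + 2 by ring] at this
    rw [this]
    push_cast
    ring
  have b2 : invFactorial (2 * j - k) = (2 * j - k + 1) * invFactorial (2 * j - (k + 1) + 2) := by
    have := invFactorial_sub_one (2 * j - (k + 1) + 2)
    rw [show (2 * j - (k + 1) + 2 - 1 : ℤ) = 2 * j - k by ring] at this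
    rw [this]
    push_cast
    ring
  simp only [relTerm, relMate]
  rw [show k + 1 + j + 1 = k + j + 1 + 1 by ring, show k + (j + 1) + 1 = k + j + 1 + 1 by ring,
    Nat.factorial_succ (k + j + 1)]
  push_cast
  rw [show (2 * (k + 1) - j : ℤ) = 2 * k + 2 - j by ring,
    show (2 * (j + 1) - k : ℤ) = 2 * j - k + 2 by ring, a2, b2, a1, b1]
  generalize invFactorial (2 * k + 2 - j) = x, invFactorial (2 * j - k + 2) = y
  linear_combination (-(3 * k + 4) * (k + j + 2) * (k + j + 1).factorial * (2 * k + 2 - j) *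
    x * y : ℚ) * hs

/-- The value of the relation at the `k`-th power. -/
def relSum (m k : ℕ) : ℚ :=
  ∑ j ∈ Finset.range m, relTerm m k j

theorem relSum_recurrence {m : ℕ} (k : ℕ) (hm : 0 < m) :
    2 * (2 * k + 3) * (k + 1 - m) * (k + m + 2) * relSum m (k + 1) -
      (k + 1) * (2 * m - k) * (2 * m + 2 + k) * relSum m k = -(3 * k + 4) * relMate m k 0 := by
  rw [relSum, relSum, Finset.mul_sum, Finset.mul_sum, ← Finset.sum_sub_distrib,
    Finset.sum_congr rfl fun j hj => relTerm_recurrence k (Finset.mem_range.1 hj),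
    ← Finset.mul_sum, Finset.sum_range_sub, relMate, relCoeff_self hm, zero_mul, zero_mul,
    zero_sub, mul_neg, neg_mul]

theorem relSum_recurrence_of_pos {m k : ℕ} (hm : 0 < m) (hk : 0 < k) :
    2 * (2 * k + 3) * (k + 1 - m) * (k + m + 2) * relSum m (k + 1) =
      (k + 1) * (2 * m - k) * (2 * m + 2 + k) * relSum m k := by
  rw [← sub_eq_zero, relSum_recurrence k hm, relMate,
    invFactorial_of_neg (z := 2 * (0 : ℕ) - k) (by simpa using hk)]
  ring

theorem relSum_one {m : ℕ} (hm : 1 < m) : relSum m 1 = 0 := by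
  have h := relSum_recurrence 0 (m := m) (by omega)
  have h0 : relSum m 0 = 2 := by
    obtain ⟨q, rfl⟩ := Nat.exists_eq_add_of_lt hm
    rw [relSum, Finset.sum_range_succ', Finset.sum_eq_zero]
    · norm_num [relTerm, relCoeff, invFactorial, show (2 : ℤ).toNat = 2 from rfl]
    · intro j _
      rw [relTerm, invFactorial_of_neg (z := 2 * (0 : ℕ) - _) (by push_cast; omega)]
      ring
  rw [h0] at h
  norm_num [relMate, relCoeff, invFactorial, show (2 : ℤ).toNat = 2 from rfl] at h
  have h2 : (1 - m : ℚ) ≠ 0 := by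
    have : (1 : ℚ) < m := mod_cast hm
    linarith
  have h3 : (m + 2 : ℚ) ≠ 0 := by positivity
  have h4 : (1 - m : ℚ) * (m + 2) * relSum m 1 = 0 := by linarith
  simpa [h2, h3] using h4

theorem relSum_eq_zero {m k : ℕ} (hk : 0 < k) (h : k < m) : relSum m k = 0 := by
  induction k, hk using Nat.le_induction with
  | base => exact relSum_one h
  | succ k hk ih =>
    have h1 := relSum_recurrence_of_pos (by omega) hk (m := m)
    rw [ih (by omega), mul_zero] at h1
    have h2 : (k + 1 - m : ℚ) ≠ 0 := by
      have : (k + 1 : ℚ) < m := mod_cast h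
      linarith
    have h3 : (0 : ℚ) < 2 * (2 * k + 3) := by positivity
    have h4 : (0 : ℚ) < k + m + 2 := by positivity
    simpa [h2, h3.ne', h4.ne'] using h1

theorem relSum_add_mul_factorial {m s t : ℕ} (hm : 0 < m) (hs : m = s + t) :
    relSum m (m + s) * (t.factorial * s.factorial * m.factorial * (3 * m + 1).factorial *
      (2 * m + s + 1).factorial * (2 * m + 2 * s + 1).factorial) =
    relSum m m * ((m + s).factorial ^ 2 * (3 * m + s + 1).factorial *
      (2 * m + 1).factorial ^ 2) := by
  induction s generalizing t with
  | zero =>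
    rw [zero_add] at hs
    rw [← hs]
    simp only [Nat.factorial_zero, add_zero, mul_zero, Nat.cast_one]
    ring
  | succ s ih =>
    have ih := ih (t := t + 1) (by omega)
    have hr := relSum_recurrence_of_pos (k := m + s) hm (by omega)
    have hm' : (m : ℚ) = s + t + 1 := by rw [hs]; push_cast; ring
    rw [← add_assoc, show 2 * m + (s + 1) + 1 = 2 * m + s + 1 + 1 by ring,
      show 2 * m + 2 * (s + 1) + 1 = 2 * m + 2 * s + 1 + 1 + 1 by ring,
      show 3 * m + (s + 1) + 1 = 3 * m + s + 1 + 1 by ring,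
      Nat.factorial_succ s, Nat.factorial_succ (2 * m + s + 1),
      Nat.factorial_succ (2 * m + 2 * s + 1 + 1), Nat.factorial_succ (2 * m + 2 * s + 1),
      Nat.factorial_succ (m + s), Nat.factorial_succ (3 * m + s + 1)]
    rw [Nat.factorial_succ t] at ih
    push_cast at ih hr ⊢
    have hr' : 2 * (2 * (m + s) + 3) * (s + 1) * (2 * m + s + 2) * relSum m (m + s + 1) =
        (m + s + 1) * (t + 1) * (3 * m + s + 2) * relSum m (m + s) := by
      linear_combination hr + (m + s + 1) * (3 * m + s + 2) * relSum m (m + s) * hm'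
    linear_combination ((m + s + 1) * (t.factorial * s.factorial * m.factorial *
      (3 * m + 1).factorial * (2 * m + s + 1).factorial * (2 * m + 2 * s + 1).factorial) : ℚ) *
      hr' + ((m + s + 1) ^ 2 * (3 * m + s + 2) : ℚ) * ih

theorem relSum_two_mul (q : ℕ) : relSum (q + 1) (2 * (q + 1)) = relCoeff (q + 1) q := by
  rw [relSum, Finset.sum_range_succ, Finset.sum_eq_zero, zero_add]
  · rw [relTerm, show (2 * (2 * (q + 1) : ℕ) - q : ℤ) = (3 * q + 4 : ℕ) by push_cast; ring,
      show (2 * q - (2 * (q + 1) : ℕ) + 2 : ℤ) = (0 : ℕ) by push_cast; ring,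
      invFactorial_natCast, invFactorial_natCast,
      show 2 * (q + 1) + q + 1 = 3 * q + 3 by ring, Nat.factorial_succ (3 * q + 3)]
    have := (3 * q + 3).factorial_ne_zero
    push_cast
    have h : (3 * q + 3 + 1 : ℚ) ≠ 0 := by positivity
    rw [Nat.factorial_zero, Nat.cast_one]
    field_simp
    ring
  · intro j hj
    rw [relTerm, invFactorial_of_neg (z := 2 * j - _ + 2), mul_zero, mul_zero]
    have := Finset.mem_range.1 hj
    push_cast
    omega

theorem relSum_self (q : ℕ) :
    relSum (q + 1) (q + 1) * ((2 * q + 2).factorial * (2 * q + 3).factorial) =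
      2 * (-1) ^ q * (3 * q + 4).factorial * (q + 1).factorial := by
  have h1 := relCoeff_mul_factorial q 0
  have h2 := relSum_add_mul_factorial (t := 0) q.succ_pos (Nat.add_zero _).symm
  rw [← two_mul, relSum_two_mul, show 3 * (q + 1) + 1 = 3 * q + 4 by ring,
    show 2 * (q + 1) + (q + 1) + 1 = 3 * q + 4 by ring,
    show 3 * (q + 1) + (q + 1) + 1 = 2 * (q + 1) + 2 * (q + 1) + 1 by ring,
    show 2 * (q + 1) + 1 = 2 * q + 3 by ring, show 2 * (q + 1) = 2 * q + 2 by ring] at h2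
  rw [Nat.factorial_succ (q + 0 + 1)] at h1
  simp only [mul_zero, add_zero] at h1
  rw [Nat.factorial_succ (2 * q + 3)] at h1
  push_cast at h1 h2
  have p (n : ℕ) : (n.factorial : ℚ) ≠ 0 := mod_cast n.factorial_ne_zero
  have hq : (q + 2 : ℚ) ≠ 0 := by positivity
  have h3 : relCoeff (q + 1) q * ((q + 1).factorial * (3 * q + 4).factorial) =
      2 * (-1) ^ q * ((2 * q + 2).factorial * (2 * q + 3).factorial) := by
    apply mul_left_cancel₀ (mul_ne_zero (mul_ne_zero (mul_ne_zero (p q) (p (q + 1)))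
      (p (2 * q + 1))) hq)
    rw [Nat.factorial_zero, Nat.cast_one] at h1
    linear_combination h1
  apply mul_left_cancel₀ (mul_ne_zero (mul_ne_zero (p (2 * q + 2)) (p (2 * q + 3)))
    (p (2 * q + 2 + (2 * q + 2) + 1)))
  rw [Nat.factorial_zero, Nat.cast_one] at h2
  linear_combination ((q + 1).factorial * (3 * q + 4).factorial *
    (2 * q + 2 + (2 * q + 2) + 1).factorial : ℚ) * h3 - h2

theorem wedgeSum_powWedge_recurrence (q : ℕ) :
    2 * wedgeSum (powWedge (q + 1)) =
      (-1) ^ q * relSum (q + 1) (q + 1) * wedgeSum (powWedge q) := by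
  obtain ⟨w, hw⟩ : ∃ w : ℚ[X], w = 2 + ∑ j ∈ Finset.range (q + 1),
      relCoeff (q + 1) j • ((X * (1 + X)) ^ (j + 1) - 2 * (X * (1 + X)) ^ j) := ⟨_, rfl⟩
  have heval : w.eval 1 = 2 := by
    rw [hw, eval_add, eval_finsetSum, Finset.sum_eq_zero]
    · simp
    · intro j _
      simp only [eval_smul, eval_sub, eval_mul, eval_pow, eval_X, eval_add, eval_one,
        eval_ofNat, smul_eq_mul]
      ring
  have hform (k : ℕ) : orderForm w ((X * (1 + X)) ^ (k + 1)) = relSum (q + 1) (k + 1) := by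
    rw [hw, map_add, LinearMap.add_apply, show (2 : ℚ[X]) = 1 + 1 by norm_num, map_add,
      LinearMap.add_apply, orderForm_one_pow k.succ_ne_zero, map_sum,
      LinearMap.sum_apply, add_zero, zero_add, relSum, one_add_one_eq_two]
    refine Finset.sum_congr rfl fun j _ => ?_
    rw [map_smul, LinearMap.smul_apply, orderForm_pow_sub,
      choose_add_choose_eq_invFactorial, relTerm, smul_eq_mul]
  have hspan : ExteriorAlgebra.ι ℚ w * powWedge (q + 1) = 0 := by
    have : w = ∑ j ∈ Finset.range (q + 1), relCoeff (q + 1) j • (X * (1 + X)) ^ (j + 1) -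
        (2 : ℚ) • ∑ j ∈ Finset.range q, relCoeff (q + 1) (j + 1) • (X * (1 + X)) ^ (j + 1) := by
      have h2 : (2 : ℚ) • (∑ j ∈ Finset.range q,
          relCoeff (q + 1) (j + 1) • (X * (1 + X)) ^ (j + 1) : ℚ[X]) =
          2 * ∑ j ∈ Finset.range q, relCoeff (q + 1) (j + 1) • (X * (1 + X)) ^ (j + 1) := by
        rw [smul_eq_C_mul]
        rfl
      simp only [hw, smul_sub, Finset.sum_sub_distrib, ← mul_smul_comm]
      rw [← Finset.mul_sum,
        Finset.sum_range_succ' (fun j => relCoeff (q + 1) j • (X * (1 + X) : ℚ[X]) ^ j),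
        relCoeff, one_smul, h2]
      ring
    rw [this, map_sub, map_smul, map_sum, map_sum, sub_mul, smul_mul_assoc, Finset.sum_mul,
      Finset.sum_mul, Finset.sum_eq_zero, Finset.sum_eq_zero, smul_zero, sub_zero]
    all_goals
      intro j hj
      have := Finset.mem_range.1 hj
      rw [map_smul, smul_mul_assoc, ι_pow_mul_powWedge (by omega), smul_zero]
  have h := wedgeSum_powWedge_succ hspan fun i hi => by
    rw [hform, relSum_eq_zero i.succ_pos (by omega)]
  rwa [heval, hform] at h

theorem wedgeSum_powWedge (m : ℕ) :
    wedgeSum (powWedge m) = ∏ i ∈ Finset.range (m + 1),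
      (((3 * i + 1).factorial : ℚ) / ((m + 1 + i).factorial : ℚ)) := by
  induction m with
  | zero => simp [powWedge, wedgeSum_one]
  | succ q ih =>
    have p (n : ℕ) : (n.factorial : ℚ) ≠ 0 := mod_cast n.factorial_ne_zero
    have h1 := wedgeSum_powWedge_recurrence q
    have h2 := relSum_self q
    have hsign : ((-1 : ℚ) ^ q) * (-1) ^ q = 1 := by rw [← mul_pow]; simp
    have h3 : wedgeSum (powWedge (q + 1)) * ((2 * q + 2).factorial * (2 * q + 3).factorial) =
        (3 * q + 4).factorial * (q + 1).factorial * wedgeSum (powWedge q) := by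
      linear_combination (((2 * q + 2).factorial * (2 * q + 3).factorial : ℚ) * h1 +
        (-1) ^ q * wedgeSum (powWedge q) * h2 +
        2 * (3 * q + 4).factorial * (q + 1).factorial * wedgeSum (powWedge q) * hsign) / 2
    have h4 : (∏ i ∈ Finset.range (q + 1 + 1), ((q + 1 + 1 + i).factorial : ℚ)) *
        (q + 1).factorial = (∏ i ∈ Finset.range (q + 1), ((q + 1 + i).factorial : ℚ)) *
        (2 * q + 2).factorial * (2 * q + 3).factorial := by
      have := Finset.prod_range_succ' (fun i => ((q + 1 + i).factorial : ℚ)) (q + 2)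
      rw [Finset.prod_range_succ, Finset.prod_range_succ,
        show q + 1 + (q + 1) = 2 * q + 2 by ring, show q + 1 + (q + 2) = 2 * q + 3 by ring] at this
      rw [this]
      simp only [add_zero, add_assoc, add_comm 1]
    have hD (n : ℕ) : ∏ i ∈ Finset.range n, ((n + i).factorial : ℚ) ≠ 0 :=
      Finset.prod_ne_zero_iff.2 fun i _ => p _
    rw [ih, Finset.prod_div_distrib] at h3
    rw [Finset.prod_div_distrib, Finset.prod_range_succ, eq_div_iff (hD _)]
    have h5 := hD (q + 1)
    field_simp at h3
    apply mul_right_cancel₀ (mul_ne_zero (mul_ne_zero (p (q + 1)) (p (2 * q + 2)))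
      (mul_ne_zero (p (2 * q + 3)) h5))
    rw [show 3 * (q + 1) + 1 = 3 * q + 4 by ring]
    linear_combination (∏ i ∈ Finset.range (q + 1 + 1), ((q + 1 + 1 + i).factorial : ℚ)) *
      (q + 1).factorial * h3 + (∏ i ∈ Finset.range (q + 1), ((3 * i + 1).factorial : ℚ)) *
      (q + 1).factorial * (3 * q + 4).factorial * h4

/-- Arrays `e d k` supported on `d + k < m`, weakly decreasing in both indices and with drops at most
one in the first index. -/
structure IsArray (m : ℕ) (e : ℕ → ℕ → ℕ) : Prop where
  eq_zero : ∀ d k, m ≤ d + k → e d k = 0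
  succ_left_le : ∀ d k, e (d + 1) k ≤ e d k
  le_succ_left : ∀ d k, e d k ≤ e (d + 1) k + 1
  succ_right_le : ∀ d k, e d (k + 1) ≤ e d k

/-- The array with `e` in its rows of positive index, whose top row is the one of `e` increased by one
in the columns `m - i` for `i ∈ s`. -/
def consRow (m : ℕ) (e : ℕ → ℕ → ℕ) (s : Finset (Fin (m + 1))) : ℕ → ℕ → ℕ
  | 0, k => e 0 k + if ∃ i ∈ s, i.val + k = m then 1 else 0
  | d + 1, k => e d k

/-- The wedge of monomials attached to the top row of an array. -/
noncomputable def rowWedge (m : ℕ) (e : ℕ → ℕ → ℕ) : ExteriorAlgebra ℚ ℚ[X] :=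
  ExteriorAlgebra.ιMulti ℚ m fun i => X ^ (e 0 (m - 1 - i) + i + 1)

theorem IsArray.wedgeSum_rowWedge {m : ℕ} {e : ℕ → ℕ → ℕ} (he : IsArray m e) :
    wedgeSum (rowWedge m e) = 1 := by
  apply wedgeSum_ιMulti_X_pow
  intro i j hij
  have := antitone_nat_of_succ_le (he.succ_right_le 0) (show m - 1 - j ≤ m - 1 - i by omega)
  have : i.val < j.val := hij
  dsimp only
  omega

theorem consRow_ite {m : ℕ} (e : ℕ → ℕ → ℕ) (s : Finset (Fin (m + 1))) (i : Fin (m + 1)) :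
    consRow m e s 0 (m - i) = e 0 (m - i) + if i ∈ s then 1 else 0 := by
  rw [consRow]
  congr 2
  refine propext ⟨fun ⟨j, hj, h⟩ => ?_, fun h => ⟨i, h, by omega⟩⟩
  rwa [show i = j by ext; omega]

theorem consRow_injective {m : ℕ} {e e' : ℕ → ℕ → ℕ} {s s' : Finset (Fin (m + 1))}
    (h : consRow m e s = consRow m e' s') : e = e' ∧ s = s' := by
  have h1 : e = e' := funext fun d => congrFun h (d + 1)
  subst h1
  refine ⟨rfl, ?_⟩
  ext i
  have := congrFun (congrFun h 0) (m - i)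
  rw [consRow_ite, consRow_ite] at this
  by_cases h1 : i ∈ s <;> by_cases h2 : i ∈ s' <;> simp_all

theorem IsArray.exists_consRow {m : ℕ} {e : ℕ → ℕ → ℕ} (he : IsArray (m + 1) e) :
    ∃ e' s, IsArray m e' ∧ consRow m e' s = e := by
  refine ⟨fun d => e (d + 1), Finset.univ.filter fun i => e 0 (m - i) = e 1 (m - i) + 1,
    ⟨fun d k h => he.eq_zero _ _ (by omega), fun d => he.succ_left_le _,
      fun d => he.le_succ_left _, fun d => he.succ_right_le _⟩, ?_⟩
  funext d k
  cases d with
  | succ d => rfl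
  | zero =>
    rcases le_or_gt k m with hk | hk
    · obtain ⟨i, rfl⟩ : ∃ i : Fin (m + 1), k = m - i := ⟨⟨m - k, by omega⟩, by simp; omega⟩
      have h1 : e 1 (m - i) ≤ e 0 (m - i) := he.succ_left_le 0 _
      have h2 : e 0 (m - i) ≤ e 1 (m - i) + 1 := he.le_succ_left 0 _
      simp only [consRow_ite, Finset.mem_filter_univ, zero_add]
      split_ifs <;> omega
    · rw [consRow, if_neg fun ⟨i, _, h⟩ => by omega, he.eq_zero _ _ (by omega),
        he.eq_zero _ _ (by omega)]

theorem IsArray.rowWedge_consRow_eq_zero {m : ℕ} {e : ℕ → ℕ → ℕ} (he : IsArray m e)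
    {s : Finset (Fin (m + 1))} (h : ¬ IsArray (m + 1) (consRow m e s)) :
    rowWedge (m + 1) (consRow m e s) = 0 := by
  obtain ⟨k, hk⟩ : ∃ k, consRow m e s 0 k < consRow m e s 0 (k + 1) := by
    by_contra! hc
    refine h ⟨fun d k hd => ?_, fun d k => ?_, fun d k => ?_, fun d k => ?_⟩
    · cases d with
      | succ d => exact he.eq_zero _ _ (by omega)
      | zero => rw [consRow, if_neg fun ⟨i, _, h⟩ => by omega, he.eq_zero _ _ (by omega)]
    · cases d with
      | succ d => exact he.succ_left_le _ _
      | zero => exact Nat.le_add_right _ _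
    · cases d with
      | succ d => exact he.le_succ_left _ _
      | zero => simp only [consRow]; split_ifs <;> omega
    · cases d with
      | succ d => exact he.succ_right_le _ _
      | zero => exact hc k
  have h1 := he.succ_right_le 0 k
  have hkm : k + 1 ≤ m := by
    by_contra! hlt
    rw [consRow, consRow, if_neg (c := ∃ i ∈ s, _ + (k + 1) = m) fun ⟨i, _, h⟩ => by omega] at hk
    omega
  have hk' : consRow m e s 0 (k + 1) = consRow m e s 0 k + 1 := by
    simp only [consRow] at hk ⊢
    split_ifs at hk ⊢ <;> omega
  rw [rowWedge]
  refine AlternatingMap.map_eq_zero_of_eq _ _ (i := ⟨m - k - 1, by omega⟩)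
    (j := ⟨m - k, by omega⟩) ?_ (by simp; omega)
  simp only
  rw [show m + 1 - 1 - (m - k - 1) = k + 1 by omega, show m + 1 - 1 - (m - k) = k by omega, hk']
  congr 1
  omega

theorem sum_rowWedge_consRow (m : ℕ) {e : ℕ → ℕ → ℕ} (he : IsArray m e) :
    ∑ s, rowWedge (m + 1) (consRow m e s) =
      ExteriorAlgebra.map (LinearMap.mulLeft ℚ (X * (1 + X)))
        (ExteriorAlgebra.ι ℚ 1 * rowWedge m e) := by
  have h : ExteriorAlgebra.ι ℚ 1 * rowWedge m e =
      ExteriorAlgebra.ιMulti ℚ (m + 1) fun i => X ^ (e 0 (m - i) + i) := by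
    rw [ExteriorAlgebra.ιMulti_succ_apply, rowWedge]
    congr 2
    · simp [he.eq_zero]
    · funext i
      simp only [Matrix.vecTail, Function.comp_apply, Fin.val_succ]
      rw [Nat.sub_sub, add_comm 1, add_assoc]
  rw [h, ExteriorAlgebra.map_apply_ιMulti]
  have h2 : (LinearMap.mulLeft ℚ (X * (1 + X)) ∘
      fun i : Fin (m + 1) => (X ^ (e 0 (m - i) + i) : ℚ[X])) =
      (fun i : Fin (m + 1) => (X ^ (e 0 (m - i) + 1 + i + 1) : ℚ[X])) +
      fun i : Fin (m + 1) => (X ^ (e 0 (m - i) + i + 1) : ℚ[X]) := by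
    funext i
    simp only [Function.comp_apply, LinearMap.mulLeft_apply, Pi.add_apply]
    ring
  rw [h2, ← AlternatingMap.coe_multilinearMap, MultilinearMap.map_add_univ]
  refine Finset.sum_congr rfl fun s _ => ?_
  rw [rowWedge, AlternatingMap.coe_multilinearMap]
  congr 1
  funext i
  rw [add_tsub_cancel_right, consRow_ite, Finset.piecewise]
  split_ifs <;> rfl

theorem map_ι_mul_powWedge (m : ℕ) :
    ExteriorAlgebra.map (LinearMap.mulLeft ℚ (X * (1 + X))) (ExteriorAlgebra.ι ℚ 1 * powWedge m) =
      powWedge (m + 1) := by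
  rw [map_mul, powWedge, ExteriorAlgebra.map_apply_ι, ExteriorAlgebra.map_apply_ιMulti, powWedge,
    ExteriorAlgebra.ιMulti_succ_apply]
  congr 2
  · simp
  · funext i
    simp [Matrix.vecTail, pow_succ', mul_assoc]

theorem exists_finset_isArray (m : ℕ) :
    ∃ E : Finset (ℕ → ℕ → ℕ), (∀ e, e ∈ E ↔ IsArray m e) ∧
      ∑ e ∈ E, rowWedge m e = powWedge m := by
  classical
  induction m with
  | zero =>
    refine ⟨{0}, fun e => ?_, by simp [rowWedge, powWedge]⟩
    rw [Finset.mem_singleton]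
    refine ⟨?_, fun h => funext₂ fun d k => h.eq_zero d k (Nat.zero_le _)⟩
    rintro rfl
    constructor <;> simp
  | succ m ih =>
    obtain ⟨E, hE, hsum⟩ := ih
    refine ⟨((E ×ˢ Finset.univ).filter fun p => IsArray (m + 1) (consRow m p.1 p.2)).image
      fun p => consRow m p.1 p.2, fun e => ?_, ?_⟩
    · simp only [Finset.mem_image, Finset.mem_filter, Finset.mem_product, Finset.mem_univ,
        and_true, hE]
      constructor
      · rintro ⟨p, ⟨_, h⟩, rfl⟩
        exact h
      · intro h
        obtain ⟨e', s, he', rfl⟩ := h.exists_consRow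
        exact ⟨(e', s), ⟨he', h⟩, rfl⟩
    · rw [Finset.sum_image fun p _ p' _ h => Prod.ext_iff.2 (consRow_injective h),
        Finset.sum_filter_of_ne, Finset.sum_product]
      · rw [Finset.sum_congr rfl fun e he => sum_rowWedge_consRow m ((hE e).1 he), ← map_sum,
          ← Finset.mul_sum, hsum, map_ι_mul_powWedge]
      · intro p hp h
        by_contra hc
        exact h (((hE _).1 (Finset.mem_product.1 hp).1).rowWedge_consRow_eq_zero hc)

theorem natCard_isArray (m : ℕ) :
    (Nat.card {e // IsArray m e} : ℚ) = ∏ i ∈ Finset.range (m + 1),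
      (((3 * i + 1).factorial : ℚ) / ((m + 1 + i).factorial : ℚ)) := by
  obtain ⟨E, hE, hsum⟩ := exists_finset_isArray m
  rw [← wedgeSum_powWedge, ← hsum, map_sum,
    Finset.sum_congr rfl fun e he => ((hE e).1 he).wedgeSum_rowWedge, Finset.sum_const,
    nsmul_one, Nat.subtype_card E hE]

end

/-- A predicate on triples of natural numbers which describes a totally symmetric self-complementary
plane partition in the cube of side `2 * n`. -/
structure IsTSSC (n : ℕ) (P : ℕ → ℕ → ℕ → Prop) : Prop where
  lt : ∀ {x y z}, P x y z → x < 2 * n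
  of_succ : ∀ {x y z}, P (x + 1) y z → P x y z
  swap_left : ∀ {x y z}, P x y z → P y x z
  swap_right : ∀ {x y z}, P x y z → P x z y
  compl : ∀ {x y z}, x < 2 * n → y < 2 * n → z < 2 * n →
    (P x y z ↔ ¬ P (2 * n - 1 - x) (2 * n - 1 - y) (2 * n - 1 - z))

namespace IsTSSC

variable {n : ℕ} {P : ℕ → ℕ → ℕ → Prop}

theorem swap_outer (h : IsTSSC n P) {x y z : ℕ} (hP : P x y z) : P z y x :=
  h.swap_left (h.swap_right (h.swap_left hP))

theorem mono_left (h : IsTSSC n P) {x x' y z : ℕ} (hP : P x y z) (hx : x' ≤ x) : P x' y z := by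
  induction x, hx using Nat.le_induction with
  | base => exact hP
  | succ x _ ih => exact ih (h.of_succ hP)

theorem mono (h : IsTSSC n P) {x x' y y' z z' : ℕ} (hP : P x y z) (hx : x' ≤ x) (hy : y' ≤ y)
    (hz : z' ≤ z) : P x' y' z' :=
  h.swap_outer <| h.mono_left (h.swap_outer <| h.swap_left <|
    h.mono_left (h.swap_left <| h.mono_left hP hx) hy) hz

end IsTSSC

/-- The points over the square of large coordinates encoded by an array. -/
def arrayTriple (e : ℕ → ℕ → ℕ) (a b k : ℕ) : Prop :=
  min a b < e (max a b - min a b) k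

theorem arrayTriple_comm {e : ℕ → ℕ → ℕ} {a b k : ℕ} :
    arrayTriple e a b k ↔ arrayTriple e b a k := by
  rw [arrayTriple, arrayTriple, min_comm, max_comm]

theorem arrayTriple_add_left (e : ℕ → ℕ → ℕ) (b d k : ℕ) :
    arrayTriple e (b + d) b k ↔ b < e d k := by
  simp [arrayTriple]

namespace IsArray

variable {m : ℕ} {e : ℕ → ℕ → ℕ}

theorem arrayTriple_of_succ_left (he : IsArray m e) {a b k : ℕ} (h : arrayTriple e (a + 1) b k) :
    arrayTriple e a b k := by
  rcases lt_or_ge a b with hab | hab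
  · obtain ⟨d, rfl⟩ := Nat.exists_eq_add_of_le (Nat.succ_le_of_lt hab)
    have := he.le_succ_left d k
    rw [arrayTriple_comm, arrayTriple_add_left] at h
    rw [arrayTriple_comm, show a.succ + d = a + (d + 1) by omega,
      arrayTriple_add_left]
    omega
  · obtain ⟨d, rfl⟩ := Nat.exists_eq_add_of_le hab
    rw [add_assoc, arrayTriple_add_left] at h
    rw [arrayTriple_add_left]
    exact h.trans_le (he.succ_left_le d k)

theorem arrayTriple_of_succ_right (he : IsArray m e) {a b k : ℕ} (h : arrayTriple e a b (k + 1)) :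
    arrayTriple e a b k :=
  h.trans_le (he.succ_right_le _ _)

theorem add_add_lt (he : IsArray m e) {b d k : ℕ} (h : b < e d k) : b + d + k < m := by
  by_contra! hm
  induction b generalizing d with
  | zero => rw [he.eq_zero d k (by omega)] at h; omega
  | succ b ih =>
    have := he.le_succ_left d k
    exact ih (d := d + 1) (by omega) (by omega)

theorem add_lt_of_arrayTriple (he : IsArray m e) {a b k : ℕ} (h : arrayTriple e a b k) :
    a + k < m := by
  have := he.add_add_lt h
  omega

end IsArray

/-- The predicate on triples encoded by an array. -/
def arrayPred (n : ℕ) (e : ℕ → ℕ → ℕ) (x y z : ℕ) : Prop :=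
  x < 2 * n ∧ y < 2 * n ∧ z < 2 * n ∧
    if n ≤ x then
      if n ≤ y then ¬ n ≤ z ∧ arrayTriple e (x - n) (y - n) z
      else if n ≤ z then arrayTriple e (x - n) (z - n) y
      else ¬ arrayTriple e (n - 1 - y) (n - 1 - z) (2 * n - 1 - x)
    else
      if n ≤ y then
        if n ≤ z then arrayTriple e (y - n) (z - n) x
        else ¬ arrayTriple e (n - 1 - x) (n - 1 - z) (2 * n - 1 - y)
      else n ≤ z → ¬ arrayTriple e (n - 1 - x) (n - 1 - y) (2 * n - 1 - z)

theorem IsArray.isTSSC_arrayPred {m : ℕ} {e : ℕ → ℕ → ℕ} (he : IsArray m e) :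
    IsTSSC (m + 1) (arrayPred (m + 1) e) where
  lt h := h.1
  of_succ {x y z} := by
    rintro ⟨hx, hy, hz, h⟩
    refine ⟨by omega, hy, hz, ?_⟩
    rcases lt_trichotomy x m with hxm | rfl | hxm
    · simp only [show ¬ m + 1 ≤ x + 1 by omega, show ¬ m + 1 ≤ x by omega, if_false] at h ⊢
      split_ifs at h ⊢
      · exact he.arrayTriple_of_succ_right h
      · refine fun h' => h (he.arrayTriple_of_succ_left ?_)
        convert h' using 1
        omega
      · refine fun hn h' => h hn (he.arrayTriple_of_succ_left ?_)
        convert h' using 1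
        omega
    · simp only [le_refl, if_true, show ¬ x + 1 ≤ x by omega, if_false] at h ⊢
      split_ifs at h ⊢ with h1 h2 h2
      · exact absurd h2 h.1
      · intro h'
        have := he.add_lt_of_arrayTriple (arrayTriple_comm.1 h.2)
        have := he.add_lt_of_arrayTriple (arrayTriple_comm.1 h')
        omega
      · intro _ h'
        have := he.add_lt_of_arrayTriple (arrayTriple_comm.1 h)
        have := he.add_lt_of_arrayTriple (arrayTriple_comm.1 h')
        omega
      · exact fun h => absurd h h2
    · simp only [show m + 1 ≤ x + 1 by omega, show m + 1 ≤ x by omega, if_true] at h ⊢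
      rw [Nat.sub_add_comm (by omega : m + 1 ≤ x)] at h
      split_ifs at h ⊢
      · exact ⟨h.1, he.arrayTriple_of_succ_left h.2⟩
      · exact he.arrayTriple_of_succ_left h
      · refine fun h' => h (he.arrayTriple_of_succ_right ?_)
        convert h' using 1
        omega
  swap_left {x y z} := by
    rintro ⟨hx, hy, hz, h⟩
    refine ⟨hy, hx, hz, ?_⟩
    split_ifs at h ⊢
    · rwa [arrayTriple_comm]
    · exact h
    · exact h
    · exact h
    · exact h
    · rwa [arrayTriple_comm]
  swap_right {x y z} := by
    rintro ⟨hx, hy, hz, h⟩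
    refine ⟨hx, hz, hy, ?_⟩
    by_cases hx' : m + 1 ≤ x <;> by_cases hy' : m + 1 ≤ y <;> by_cases hz' : m + 1 ≤ z <;>
      simp_all [arrayTriple_comm]
  compl {x y z} hx hy hz := by
    simp only [arrayPred, hx, hy, hz, true_and,
      show ∀ a, 2 * (m + 1) - 1 - a < 2 * (m + 1) by omega]
    have hsub {a : ℕ} (ha : a < 2 * (m + 1)) : 2 * (m + 1) - 1 - (2 * (m + 1) - 1 - a) = a := by
      omega
    have hle (a : ℕ) : m + 1 ≤ 2 * (m + 1) - 1 - a ↔ ¬ m + 1 ≤ a := by omega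
    have h1 {a : ℕ} (ha : a < 2 * (m + 1)) (ha' : m + 1 ≤ a) :
        m - (2 * (m + 1) - 1 - a) = a - (m + 1) := by
      omega
    have h2 (a : ℕ) : 2 * (m + 1) - 1 - a - (m + 1) = m + 1 - 1 - a := by omega
    simp only [hle, hsub hx, hsub hy, hsub hz, h2]
    by_cases hx' : m + 1 ≤ x <;> by_cases hy' : m + 1 ≤ y <;> by_cases hz' : m + 1 ≤ z <;>
      simp [hx', hy', hz', h1, hx, hy, hz]

theorem IsTSSC.exists_isArray {m : ℕ} {P : ℕ → ℕ → ℕ → Prop} (h : IsTSSC (m + 1) P) :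
    ∃ e, IsArray m e ∧
      ∀ b d k, b < e d k ↔ k ≤ m ∧ P (m + 1 + b + d) (m + 1 + b) k := by
  classical
  have hfin (d k : ℕ) : ∃ b, ¬ (k ≤ m ∧ P (m + 1 + b + d) (m + 1 + b) k) :=
    ⟨m + 1, fun hb => by have := h.lt hb.2; omega⟩
  have key (b d k : ℕ) : b < Nat.find (hfin d k) ↔ k ≤ m ∧ P (m + 1 + b + d) (m + 1 + b) k :=
    (Nat.lt_find_iff _ _).trans ⟨fun hb => not_not.1 (hb b le_rfl), fun hb c hc =>
      not_not.2 ⟨hb.1, h.mono hb.2 (by omega) (by omega) le_rfl⟩⟩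
  refine ⟨fun d k => Nat.find (hfin d k), ⟨fun d k hdk => ?_, fun d k => ?_, fun d k => ?_,
    fun d k => ?_⟩, key⟩
  · by_contra hne
    obtain ⟨hk, hP⟩ := (key 0 d k).1 (Nat.pos_of_ne_zero hne)
    have hd := h.lt hP
    refine (h.compl hd (by omega) (by omega)).1 hP (h.mono (h.swap_outer hP) ?_ ?_ ?_) <;> omega
  · refine le_of_forall_lt fun b hb => ?_
    obtain ⟨hk, hP⟩ := (key _ _ _).1 hb
    exact (key _ _ _).2 ⟨hk, h.mono hP (by omega) le_rfl le_rfl⟩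
  · refine le_of_forall_lt fun b hb => ?_
    cases b with
    | zero => omega
    | succ b =>
      obtain ⟨hk, hP⟩ := (key _ _ _).1 hb
      exact Nat.succ_lt_succ ((key _ _ _).2 ⟨hk, h.mono hP (by omega) (by omega) le_rfl⟩)
  · refine le_of_forall_lt fun b hb => ?_
    obtain ⟨hk, hP⟩ := (key _ _ _).1 hb
    exact (key _ _ _).2 ⟨by omega, h.mono hP le_rfl le_rfl (by omega)⟩

theorem IsTSSC.ext {n : ℕ} {P Q : ℕ → ℕ → ℕ → Prop} (hP : IsTSSC n P) (hQ : IsTSSC n Q)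
    (h : ∀ b d k, k < n → (P (n + b + d) (n + b) k ↔ Q (n + b + d) (n + b) k)) : P = Q := by
  suffices ∀ {P Q : ℕ → ℕ → ℕ → Prop}, IsTSSC n P → IsTSSC n Q →
      (∀ b d k, k < n → (P (n + b + d) (n + b) k ↔ Q (n + b + d) (n + b) k)) →
      ∀ {x y z}, P x y z → Q x y z by
    funext x y z
    exact propext ⟨this hP hQ h, this hQ hP fun b d k hk => (h b d k hk).symm⟩
  clear h hP hQ P Q
  intro P Q hP hQ h x y z hxyz
  have sorted : ∀ {x y z}, z ≤ y → y ≤ x → P x y z → Q x y z := by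
    intro x y z hzy hyx hxyz
    have hx := hP.lt hxyz
    have hall : ∀ {R}, IsTSSC n R → ¬ R n n n := fun {R} hR hc =>
      (hR.compl (by omega) (by omega) (by omega)).1 hc
        (hR.mono hc (by omega) (by omega) (by omega))
    have hz : z < n := by
      by_contra! hz
      exact hall hP (hP.mono hxyz (by omega) (by omega) hz)
    have two {x y z} (hz : z < n) (hy : n ≤ y) (hyx : y ≤ x) : P x y z ↔ Q x y z := by
      obtain ⟨b, rfl⟩ := Nat.exists_eq_add_of_le hy
      obtain ⟨d, rfl⟩ := Nat.exists_eq_add_of_le hyx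
      exact h b d z hz
    rcases le_or_gt n y with hy | hy
    · exact (two hz hy hyx).1 hxyz
    · rw [hQ.compl hx (by omega) (by omega)]
      intro hc
      rcases le_or_gt n x with hx' | hx'
      · refine (hP.compl hx (by omega) (by omega)).1 hxyz (hP.swap_outer ?_)
        exact (two (by omega) (by omega) (by omega)).2 (hQ.swap_outer hc)
      · exact hall hQ (hQ.mono hc (by omega) (by omega) (by omega))
  rcases le_total x y with a | a <;> rcases le_total y z with b | b
  · exact hQ.swap_outer (sorted a b (hP.swap_outer hxyz))
  · rcases le_total x z with c | c
    · exact hQ.swap_left (hQ.swap_right (sorted c b (hP.swap_right (hP.swap_left hxyz))))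
    · exact hQ.swap_left (sorted c a (hP.swap_left hxyz))
  · rcases le_total x z with c | c
    · exact hQ.swap_right (hQ.swap_left (sorted a c (hP.swap_left (hP.swap_right hxyz))))
    · exact hQ.swap_right (sorted b c (hP.swap_right hxyz))
  · exact sorted b a hxyz

theorem IsArray.arrayPred_iff {m : ℕ} {e : ℕ → ℕ → ℕ} (he : IsArray m e) {b d k : ℕ}
    (hk : k < m + 1) : arrayPred (m + 1) e (m + 1 + b + d) (m + 1 + b) k ↔ b < e d k := by
  have h : arrayPred (m + 1) e (m + 1 + b + d) (m + 1 + b) k ↔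
      m + 1 + b + d < 2 * (m + 1) ∧ b < e d k := by
    rw [arrayPred, if_pos (by omega), if_pos (by omega), add_assoc (m + 1), add_tsub_cancel_left,
      add_tsub_cancel_left, arrayTriple_add_left]
    refine ⟨fun h => ⟨h.1, h.2.2.2.2⟩, fun h => ⟨h.1, ?_, ?_, ?_, h.2⟩⟩ <;> omega
  rw [h]
  refine ⟨And.right, fun hb => ⟨?_, hb⟩⟩
  have := he.add_add_lt hb
  omega

theorem natCard_isTSSC (m : ℕ) :
    Nat.card {P // IsTSSC (m + 1) P} = Nat.card {e // IsArray m e} := by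
  symm
  refine Nat.card_eq_of_bijective (fun e => ⟨arrayPred (m + 1) e.1, e.2.isTSSC_arrayPred⟩) ⟨?_, ?_⟩
  · rintro ⟨e, he⟩ ⟨e', he'⟩ h
    have h : arrayPred (m + 1) e = arrayPred (m + 1) e' := congrArg Subtype.val h
    refine Subtype.ext (funext₂ fun d k => ?_)
    rcases lt_or_ge k (m + 1) with hk | hk
    · refine eq_of_forall_lt_iff fun b => ?_
      rw [← he.arrayPred_iff hk, ← he'.arrayPred_iff hk, h]
    · exact (he.eq_zero d k (by omega)).trans (he'.eq_zero d k (by omega)).symm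
  · rintro ⟨P, hP⟩
    obtain ⟨e, he, h⟩ := hP.exists_isArray
    refine ⟨⟨e, he⟩, Subtype.ext (he.isTSSC_arrayPred.ext hP fun b d k hk => ?_)⟩
    rw [he.arrayPred_iff hk, h, and_iff_right (Nat.le_of_lt_succ hk)]

theorem natCard_tsscpp (n : ℕ) :
    Nat.card {S : Set (Fin (2 * n) × Fin (2 * n) × Fin (2 * n)) //
        IsLowerSet S ∧
        (∀ i j k, (i, j, k) ∈ S ↔ (i, k, j) ∈ S) ∧
        (∀ i j k, (i, j, k) ∈ S ↔ (j, i, k) ∈ S) ∧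
        (∀ i j k, (i, j, k) ∈ S ↔ (j, k, i) ∈ S) ∧
        (∀ i j k, (i, j, k) ∈ S ↔ (k, i, j) ∈ S) ∧
        (∀ i j k, (i, j, k) ∈ S ↔ (k, j, i) ∈ S) ∧
        (∀ i j k, (i, j, k) ∈ S ↔ (i.rev, j.rev, k.rev) ∉ S)} =
      Nat.card {P // IsTSSC n P} := by
  refine Nat.card_eq_of_bijective (fun S => ⟨fun x y z => ∃ hx hy hz,
    ((⟨x, hx⟩, ⟨y, hy⟩, ⟨z, hz⟩) : Fin (2 * n) × Fin (2 * n) × Fin (2 * n)) ∈ S.1, ?_⟩) ⟨?_, ?_⟩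
  · obtain ⟨S, hS, h1, h2, h3, h4, h5, h6⟩ := S
    refine ⟨fun ⟨hx, _⟩ => hx, ?_, ?_, ?_, ?_⟩
    · rintro x y z ⟨hx, hy, hz, h⟩
      have hx' := (Nat.lt_succ_self x).trans hx
      have hle : (⟨x, hx'⟩ : Fin (2 * n)) ≤ ⟨x + 1, hx⟩ := x.le_succ
      exact ⟨hx', hy, hz, hS (Prod.mk_le_mk.2 ⟨hle, le_rfl⟩) h⟩
    · rintro x y z ⟨hx, hy, hz, h⟩
      exact ⟨hy, hx, hz, (h2 _ _ _).1 h⟩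
    · rintro x y z ⟨hx, hy, hz, h⟩
      exact ⟨hx, hz, hy, (h1 _ _ _).1 h⟩
    · intro x y z hx hy hz
      have hrev {a : ℕ} (ha : a < 2 * n) : (⟨2 * n - 1 - a, by omega⟩ : Fin (2 * n)) =
          (⟨a, ha⟩ : Fin (2 * n)).rev := by
        ext
        simp only [Fin.val_rev]
        omega
      simp only [hx, hy, hz, show ∀ a, a < 2 * n → 2 * n - 1 - a < 2 * n by omega,
        exists_true_left, hrev]
      exact h6 _ _ _
  · intro S S' h
    have h := congrArg Subtype.val h
    refine Subtype.ext (Set.ext fun ⟨x, y, z⟩ => ?_)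
    simpa using congrFun (congrFun (congrFun h x) y) z
  · rintro ⟨P, hP⟩
    have h1 {x y z : ℕ} : P x y z ↔ P x z y := ⟨hP.swap_right, hP.swap_right⟩
    have h2 {x y z : ℕ} : P x y z ↔ P y x z := ⟨hP.swap_left, hP.swap_left⟩
    refine ⟨⟨{p | P p.1 p.2.1 p.2.2}, ?_, fun _ _ _ => h1, fun _ _ _ => h2,
      fun _ _ _ => h2.trans h1, fun _ _ _ => h1.trans h2,
      fun _ _ _ => h1.trans (h2.trans h1), fun i j k => ?_⟩, Subtype.ext ?_⟩
    · exact fun p q hqp hp => hP.mono hp hqp.1 hqp.2.1 hqp.2.2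
    · have h := hP.compl i.2 j.2 k.2
      simpa only [Set.mem_ofPred_eq, Fin.val_rev, Nat.sub_sub, add_comm 1] using h
    · funext x y z
      refine propext ⟨fun ⟨_, _, _, h⟩ => h, fun h => ⟨hP.lt h, hP.lt (hP.swap_left h),
        hP.lt (hP.swap_outer h), h⟩⟩

open Finset

theorem TSSC_count (n : ℕ) (hn : 0 < n) :
    (Nat.card {S : Set (Fin (2 * n) × Fin (2 * n) × Fin (2 * n)) //
        IsLowerSet S ∧
        (∀ i j k, (i, j, k) ∈ S ↔ (i, k, j) ∈ S) ∧
        (∀ i j k, (i, j, k) ∈ S ↔ (j, i, k) ∈ S) ∧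
        (∀ i j k, (i, j, k) ∈ S ↔ (j, k, i) ∈ S) ∧
        (∀ i j k, (i, j, k) ∈ S ↔ (k, i, j) ∈ S) ∧
        (∀ i j k, (i, j, k) ∈ S ↔ (k, j, i) ∈ S) ∧
        (∀ i j k, (i, j, k) ∈ S ↔ (i.rev, j.rev, k.rev) ∉ S)} : ℚ) =
      ∏ i ∈ Finset.range n,
        (((3 * i + 1).factorial : ℚ) / ((n + i).factorial : ℚ)) := by
  obtain ⟨m, rfl⟩ := Nat.exists_eq_add_of_le' hn
  rw [natCard_tsscpp, natCard_isTSSC, natCard_isArray]
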